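/- If D ⊆ L is a factorial collection of words and φ : X → ℝ is continuous, then lim_{n→∞} (1/n) log Λ_n(D) = P(X_D, φ), the topological pressure of φ restricted to the subshift X_D of sequences all of whose subwords lie in D. -/

import Mathlib

open Filter Real

/-- The shift map on bi-infinite sequences. -/
def shift {A : Type*} (x : ℤ → A) : ℤ → A := fun n => x (n + 1)

/-- Birkhoff sum `S_n φ`. -/
noncomputable def birk {A : Type*} (φ : (ℤ → A) → ℝ) (n : ℕ) (x : ℤ → A) : ℝ :=
  ∑ k ∈ Finset.range n, φ (shift^[k] x)

/-- Forward cylinder of a word `w : List A` inside `X`. -/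
def cylL {A : Type*} (X : Set (ℤ → A)) (w : List A) : Set (ℤ → A) :=
  {x ∈ X | ∀ i : Fin w.length, x ((i : ℕ) : ℤ) = w.get i}

/-- The language of `X` (as a set of words). -/
def langSet {A : Type*} (X : Set (ℤ → A)) : Set (List A) :=
  {w : List A | (cylL X w).Nonempty}

/-- The weight `Φ(w) = sup_{x ∈ [w]^+} S_{|w|} φ(x)`. -/
noncomputable def PhiL {A : Type*} (X : Set (ℤ → A)) (φ : (ℤ → A) → ℝ) (w : List A) : ℝ :=
  sSup (birk φ w.length '' cylL X w)

open Classical in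
/-- Partition sum restricted to a collection of words:
`Λ_n(D) = Σ_{w ∈ D, |w| = n} e^{Φ(w)}`. -/
noncomputable def LamD {A : Type*} [Fintype A] (X : Set (ℤ → A)) (φ : (ℤ → A) → ℝ)
    (D : Set (List A)) (n : ℕ) : ℝ :=
  ∑ w : Fin n → A, if List.ofFn w ∈ D then Real.exp (PhiL X φ (List.ofFn w)) else 0

/-- The subword of `x` of length `n` starting at coordinate `i`. -/
def subword {A : Type*} (x : ℤ → A) (i : ℤ) (n : ℕ) : List A :=
  List.ofFn (fun k : Fin n => x (i + (k : ℕ)))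

/-- The subshift determined by a factorial collection `D`: all points of `X` all of
whose finite subwords lie in `D`. -/
def subshiftOf {A : Type*} (X : Set (ℤ → A)) (D : Set (List A)) : Set (ℤ → A) :=
  {x ∈ X | ∀ (i : ℤ) (n : ℕ), subword x i n ∈ D}

section Words

variable {A : Type*}

theorem shift_iterate_apply (x : ℤ → A) (m : ℕ) (n : ℤ) : (shift^[m] x) n = x (n + m) := by
  induction m generalizing x n with
  | zero => simp
  | succ k ih =>
    rw [Function.iterate_succ_apply, ih]
    simp only [shift]
    congr 1
    push_cast
    ring

theorem shift_iterate_mem {X : Set (ℤ → A)} (hX : ∀ x ∈ X, shift x ∈ X) {x : ℤ → A} (hx : x ∈ X)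
    (m : ℕ) : shift^[m] x ∈ X := by
  induction m with
  | zero => exact hx
  | succ k ih =>
    rw [Function.iterate_succ_apply']
    exact hX _ ih

@[simp]
theorem length_subword (x : ℤ → A) (i : ℤ) (n : ℕ) : (subword x i n).length = n := by
  simp [subword]

theorem subword_shift_iterate (x : ℤ → A) (m : ℕ) (i : ℤ) (n : ℕ) :
    subword (shift^[m] x) i n = subword x (i + m) n := by
  simp only [subword, shift_iterate_apply, add_right_comm]

theorem subword_add (x : ℤ → A) (i : ℤ) (m n : ℕ) :
    subword x i (m + n) = subword x i m ++ subword x (i + m) n := by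
  simp [subword, List.ofFn_add, add_assoc]

theorem mem_cylL_iff {X : Set (ℤ → A)} {w : List A} {x : ℤ → A} :
    x ∈ cylL X w ↔ x ∈ X ∧ subword x 0 w.length = w := by
  refine and_congr_right fun _ => ?_
  rw [List.ext_get_iff]
  simp only [subword, List.length_ofFn, true_and, List.get_ofFn, zero_add]
  constructor
  · intro h n h₁ h₂
    exact h ⟨n, h₂⟩
  · intro h i
    exact h i i.2 i.2

theorem mem_cylL_append {X : Set (ℤ → A)} (hX : ∀ x ∈ X, shift x ∈ X) {u v : List A} {x : ℤ → A}
    (hx : x ∈ cylL X (u ++ v)) : x ∈ cylL X u ∧ shift^[u.length] x ∈ cylL X v := by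
  rw [mem_cylL_iff, List.length_append, subword_add] at hx
  obtain ⟨hxX, hx⟩ := hx
  obtain ⟨h₁, h₂⟩ := List.append_inj hx (by simp)
  refine ⟨mem_cylL_iff.2 ⟨hxX, h₁⟩, mem_cylL_iff.2 ⟨shift_iterate_mem hX hxX _, ?_⟩⟩
  rw [subword_shift_iterate, h₂]

theorem birk_add (φ : (ℤ → A) → ℝ) (m n : ℕ) (x : ℤ → A) :
    birk φ (m + n) x = birk φ m x + birk φ n (shift^[m] x) := by
  simp only [birk, Finset.sum_range_add]
  congr 1
  refine Finset.sum_congr rfl fun k _ => ?_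
  rw [← Function.iterate_add_apply, add_comm]

theorem abs_birk_le {X : Set (ℤ → A)} (hX : ∀ x ∈ X, shift x ∈ X) {φ : (ℤ → A) → ℝ} {M : ℝ}
    (hM : ∀ x ∈ X, |φ x| ≤ M) {x : ℤ → A} (hx : x ∈ X) (n : ℕ) : |birk φ n x| ≤ n * M := by
  refine (Finset.abs_sum_le_sum_abs _ _).trans ?_
  refine (Finset.sum_le_sum fun k _ => hM _ (shift_iterate_mem hX hx k)).trans ?_
  simp

theorem bddAbove_birk {X : Set (ℤ → A)} (hX : ∀ x ∈ X, shift x ∈ X) {φ : (ℤ → A) → ℝ} {M : ℝ}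
    (hM : ∀ x ∈ X, |φ x| ≤ M) (n : ℕ) (w : List A) : BddAbove (birk φ n '' cylL X w) := by
  refine ⟨n * M, ?_⟩
  rintro _ ⟨x, hx, rfl⟩
  exact (abs_le.1 (abs_birk_le hX hM hx.1 n)).2

theorem birk_le_PhiL {X : Set (ℤ → A)} (hX : ∀ x ∈ X, shift x ∈ X) {φ : (ℤ → A) → ℝ} {M : ℝ}
    (hM : ∀ x ∈ X, |φ x| ≤ M) {w : List A} {x : ℤ → A} (hx : x ∈ cylL X w) :
    birk φ w.length x ≤ PhiL X φ w :=
  le_csSup (bddAbove_birk hX hM _ w) ⟨x, hx, rfl⟩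

theorem PhiL_le {X : Set (ℤ → A)} {φ : (ℤ → A) → ℝ} {w : List A} (hw : w ∈ langSet X) {c : ℝ}
    (h : ∀ x ∈ cylL X w, birk φ w.length x ≤ c) : PhiL X φ w ≤ c :=
  csSup_le (hw.image _) (by rintro _ ⟨x, hx, rfl⟩; exact h x hx)

theorem PhiL_append_le {X : Set (ℤ → A)} (hX : ∀ x ∈ X, shift x ∈ X) {φ : (ℤ → A) → ℝ} {M : ℝ}
    (hM : ∀ x ∈ X, |φ x| ≤ M) {u v : List A} (h : u ++ v ∈ langSet X) :
    PhiL X φ (u ++ v) ≤ PhiL X φ u + PhiL X φ v := by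
  refine PhiL_le h fun x hx => ?_
  obtain ⟨h₁, h₂⟩ := mem_cylL_append hX hx
  rw [List.length_append, birk_add]
  exact add_le_add (birk_le_PhiL hX hM h₁) (birk_le_PhiL hX hM h₂)

theorem langSet_append {X : Set (ℤ → A)} (hX : ∀ x ∈ X, shift x ∈ X) {u v : List A}
    (h : u ++ v ∈ langSet X) : u ∈ langSet X ∧ v ∈ langSet X := by
  obtain ⟨x, hx⟩ := h
  obtain ⟨h₁, h₂⟩ := mem_cylL_append hX hx
  exact ⟨⟨_, h₁⟩, ⟨_, h₂⟩⟩

theorem shift_mem_subshiftOf {X : Set (ℤ → A)} (hX : ∀ x ∈ X, shift x ∈ X) (D : Set (List A)) :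
    ∀ x ∈ subshiftOf X D, shift x ∈ subshiftOf X D := fun x hx =>
  ⟨hX x hx.1, fun i n => by simpa using subword_shift_iterate x 1 i n ▸ hx.2 (i + (1 : ℕ)) n⟩

theorem cylL_mono {X Y : Set (ℤ → A)} (h : Y ⊆ X) (w : List A) : cylL Y w ⊆ cylL X w :=
  fun _ hx => ⟨h hx.1, hx.2⟩

theorem subshiftOf_subset (X : Set (ℤ → A)) (D : Set (List A)) : subshiftOf X D ⊆ X :=
  fun _ hx => hx.1

theorem langSet_subshiftOf_subset (X : Set (ℤ → A)) (D : Set (List A)) :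
    langSet (subshiftOf X D) ⊆ D := by
  rintro w ⟨x, hx⟩
  obtain ⟨h₁, h₂⟩ := mem_cylL_iff.1 hx
  exact h₂ ▸ h₁.2 0 _

/-- The words of `D` that can be extended within `D` by `j` letters on each side. -/
def extCore (D : Set (List A)) (j : ℕ) : Set (List A) :=
  {w | ∃ u v : List A, u.length = j ∧ v.length = j ∧ u ++ w ++ v ∈ D}

theorem extCore_subset {D : Set (List A)} (hfac : ∀ w ∈ D, ∀ u : List A, u <:+: w → u ∈ D)
    (j : ℕ) : extCore D j ⊆ D := by
  rintro w ⟨u, v, -, -, h⟩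
  exact hfac _ h _ ⟨u, v, rfl⟩

theorem extCore_factorial {D : Set (List A)} (hfac : ∀ w ∈ D, ∀ u : List A, u <:+: w → u ∈ D)
    (j : ℕ) : ∀ w ∈ extCore D j, ∀ u : List A, u <:+: w → u ∈ extCore D j := by
  rintro _ ⟨u, v, hu, hv, h⟩ w ⟨s, t, rfl⟩
  refine ⟨(u ++ s).drop s.length, (t ++ v).take j, by simp [hu], by simp [hv], hfac _ h _ ?_⟩
  refine ⟨(u ++ s).take s.length, (t ++ v).drop j, ?_⟩
  calc _ = ((u ++ s).take s.length ++ (u ++ s).drop s.length) ++ w ++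
        ((t ++ v).take j ++ (t ++ v).drop j) := by simp only [List.append_assoc]
    _ = _ := by simp only [List.take_append_drop, List.append_assoc]

theorem extCore_antitone {D : Set (List A)} (hfac : ∀ w ∈ D, ∀ u : List A, u <:+: w → u ∈ D) :
    Antitone (extCore D) := by
  rintro j k hjk w ⟨u, v, hu, hv, h⟩
  refine ⟨u.drop (k - j), v.take j, by simp [hu]; omega, by simp [hv, hjk], hfac _ h _ ?_⟩
  refine ⟨u.take (k - j), v.drop j, ?_⟩
  calc _ = (u.take (k - j) ++ u.drop (k - j)) ++ w ++ (v.take j ++ v.drop j) := by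
        simp only [List.append_assoc]
    _ = _ := by simp only [List.take_append_drop]

end Words

section PartitionSums

variable {A : Type*} [Fintype A]

theorem LamD_nonneg (X : Set (ℤ → A)) (φ : (ℤ → A) → ℝ) (D : Set (List A)) (n : ℕ) :
    0 ≤ LamD X φ D n :=
  Finset.sum_nonneg fun w _ => by split_ifs <;> positivity

theorem LamD_eq_zero (X : Set (ℤ → A)) (φ : (ℤ → A) → ℝ) {D : Set (List A)} {n : ℕ}
    (h : ∀ w ∈ D, w.length ≠ n) : LamD X φ D n = 0 :=
  Finset.sum_eq_zero fun w _ => if_neg fun hw => h _ hw (by simp)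

theorem LamD_le_mul_of_forall {X Y : Set (ℤ → A)} {φ : (ℤ → A) → ℝ} {D E : Set (List A)} {n : ℕ}
    {c : ℝ} (h : ∀ w ∈ D, w.length = n → w ∈ E ∧ PhiL X φ w ≤ c + PhiL Y φ w) :
    LamD X φ D n ≤ Real.exp c * LamD Y φ E n := by
  rw [LamD, LamD, Finset.mul_sum]
  refine Finset.sum_le_sum fun w _ => ?_
  by_cases hw : List.ofFn w ∈ D
  · obtain ⟨h₁, h₂⟩ := h _ hw (by simp)
    rw [if_pos hw, if_pos h₁, ← Real.exp_add]
    exact Real.exp_le_exp.2 h₂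
  · rw [if_neg hw]
    split_ifs <;> positivity

open Classical in
theorem exp_neg_le_LamD {X : Set (ℤ → A)} (hX : ∀ x ∈ X, shift x ∈ X) {φ : (ℤ → A) → ℝ} {M : ℝ}
    (hM : ∀ x ∈ X, |φ x| ≤ M) {D : Set (List A)} (hD : D ⊆ langSet X) {w : List A} (hw : w ∈ D) :
    Real.exp (-(w.length * M)) ≤ LamD X φ D w.length := by
  have hw' : List.ofFn w.get = w := List.ofFn_get w
  refine le_trans ?_ (Finset.single_le_sum (f := fun v : Fin w.length → A =>
    if List.ofFn v ∈ D then Real.exp (PhiL X φ (List.ofFn v)) else 0)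
    (fun v _ => by split_ifs <;> positivity) (Finset.mem_univ w.get))
  simp only [hw', if_pos hw]
  obtain ⟨x, hx⟩ := hD hw
  exact Real.exp_le_exp.2
    ((abs_le.1 (abs_birk_le hX hM hx.1 _)).1.trans (birk_le_PhiL hX hM hx))

open Classical in
theorem LamD_add_le {X : Set (ℤ → A)} (hX : ∀ x ∈ X, shift x ∈ X) {φ : (ℤ → A) → ℝ} {M : ℝ}
    (hM : ∀ x ∈ X, |φ x| ≤ M) {D E F : Set (List A)} (hD : D ⊆ langSet X) {m n : ℕ}
    (h : ∀ u v : List A, u.length = m → v.length = n → u ++ v ∈ D → u ∈ E ∧ v ∈ F) :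
    LamD X φ D (m + n) ≤ LamD X φ E m * LamD X φ F n := by
  rw [LamD, LamD, LamD, Finset.sum_mul_sum, ← Finset.sum_product', Finset.univ_product_univ,
    ← (Fin.appendEquiv m n).sum_comp]
  refine Finset.sum_le_sum fun p _ => ?_
  change (if List.ofFn (Fin.append p.1 p.2) ∈ D then
    Real.exp (PhiL X φ (List.ofFn (Fin.append p.1 p.2))) else 0) ≤ _
  rw [List.ofFn_fin_append]
  by_cases hp : List.ofFn p.1 ++ List.ofFn p.2 ∈ D
  · obtain ⟨h₁, h₂⟩ := h _ _ (by simp) (by simp) hp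
    rw [if_pos hp, if_pos h₁, if_pos h₂, ← Real.exp_add]
    exact Real.exp_le_exp.2 (PhiL_append_le hX hM (hD hp))
  · rw [if_neg hp]
    split_ifs <;> positivity

theorem LamD_mul_le_pow {X : Set (ℤ → A)} (hX : ∀ x ∈ X, shift x ∈ X) {φ : (ℤ → A) → ℝ} {M : ℝ}
    (hM : ∀ x ∈ X, |φ x| ≤ M) {D : Set (List A)} (hD : D ⊆ langSet X)
    (hfac : ∀ w ∈ D, ∀ u : List A, u <:+: w → u ∈ D) (n k : ℕ) :
    LamD X φ D (n * (k + 1)) ≤ LamD X φ D n ^ (k + 1) := by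
  induction k with
  | zero => simp
  | succ k ih =>
    rw [Nat.mul_succ n (k + 1), pow_succ]
    refine (LamD_add_le hX hM hD fun u v _ _ h =>
      ⟨hfac _ h _ (List.prefix_append u v).isInfix,
        hfac _ h _ (List.suffix_append u v).isInfix⟩).trans ?_
    exact mul_le_mul_of_nonneg_right ih (LamD_nonneg _ _ _ _)

theorem LamD_le_extCore {X : Set (ℤ → A)} (hX : ∀ x ∈ X, shift x ∈ X) {φ : (ℤ → A) → ℝ} {M : ℝ}
    (hM : ∀ x ∈ X, |φ x| ≤ M) {D : Set (List A)} (hD : D ⊆ langSet X)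
    (hfac : ∀ w ∈ D, ∀ u : List A, u <:+: w → u ∈ D) (j n : ℕ) :
    LamD X φ D (j + (n + j)) ≤
      LamD X φ D j * (LamD X φ (extCore D j) n * LamD X φ D j) := by
  let G : Set (List A) := {w | ∃ u : List A, u.length = j ∧ u ++ w ∈ D}
  have hG : G ⊆ D := by
    rintro w ⟨u, -, h⟩
    exact hfac _ h _ (List.suffix_append u w).isInfix
  have h₁ : LamD X φ D (j + (n + j)) ≤ LamD X φ D j * LamD X φ G (n + j) :=
    LamD_add_le hX hM hD fun u v hu _ h =>
      ⟨hfac _ h _ (List.prefix_append u v).isInfix, u, hu, h⟩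
  have h₂ : LamD X φ G (n + j) ≤ LamD X φ (extCore D j) n * LamD X φ D j := by
    refine LamD_add_le hX hM (hG.trans hD) fun w v _ hv h => ?_
    refine ⟨?_, hfac _ (hG h) _ (List.suffix_append w v).isInfix⟩
    obtain ⟨u, hu, h⟩ := h
    exact ⟨u, v, hu, hv, by rwa [List.append_assoc]⟩
  exact h₁.trans (mul_le_mul_of_nonneg_left h₂ (LamD_nonneg _ _ _ _))

theorem subadditive_log_LamD {X : Set (ℤ → A)} (hX : ∀ x ∈ X, shift x ∈ X) {φ : (ℤ → A) → ℝ}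
    {M : ℝ} (hM : ∀ x ∈ X, |φ x| ≤ M) {D : Set (List A)} (hD : D ⊆ langSet X)
    (happ : ∀ u v : List A, u ++ v ∈ D → u ∈ D ∧ v ∈ D) (hpos : ∀ n, 0 < LamD X φ D n) :
    Subadditive fun n => Real.log (LamD X φ D n) := fun m n => by
  rw [← Real.log_mul (hpos m).ne' (hpos n).ne']
  exact Real.log_le_log (hpos _) (LamD_add_le hX hM hD fun u v _ _ h => happ u v h)

theorem bddBelow_log_LamD_div {X : Set (ℤ → A)} (hX : ∀ x ∈ X, shift x ∈ X) {φ : (ℤ → A) → ℝ}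
    {M : ℝ} (hM : ∀ x ∈ X, |φ x| ≤ M) {D : Set (List A)} (hD : D ⊆ langSet X)
    (hne : ∀ n, ∃ w ∈ D, w.length = n) :
    BddBelow (Set.range fun n : ℕ => Real.log (LamD X φ D n) / n) := by
  refine ⟨min 0 (-M), ?_⟩
  rintro _ ⟨n, rfl⟩
  rcases n.eq_zero_or_pos with rfl | hn
  · simp
  · refine (min_le_right _ _).trans ?_
    obtain ⟨w, hw, rfl⟩ := hne n
    have h := exp_neg_le_LamD hX hM hD hw
    have hn' : (0 : ℝ) < w.length := by exact_mod_cast hn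
    dsimp only
    rw [le_div_iff₀ hn']
    have := (Real.le_log_iff_exp_le ((Real.exp_pos _).trans_le h)).2 h
    linarith

end PartitionSums

section Compactness

variable {A : Type*} [TopologicalSpace A] [DiscreteTopology A]

theorem isClosed_setOf_subword_mem (i : ℤ) (n : ℕ) (D : Set (List A)) :
    IsClosed {x : ℤ → A | subword x i n ∈ D} := by
  have hc : Continuous fun (x : ℤ → A) (k : Fin n) => x (i + (k : ℕ)) := by fun_prop
  exact (isClosed_discrete {w : Fin n → A | List.ofFn w ∈ D}).preimage hc

variable [Fintype A]

theorem mem_langSet_subshiftOf {X : Set (ℤ → A)} (hXcl : IsClosed X)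
    (hX : ∀ x ∈ X, shift x ∈ X) {D : Set (List A)} (hD : D ⊆ langSet X)
    (hfac : ∀ w ∈ D, ∀ u : List A, u <:+: w → u ∈ D) {w : List A}
    (hw : ∀ j, w ∈ extCore D j) : w ∈ langSet (subshiftOf X D) := by
  let t : ℕ → Set (ℤ → A) := fun j =>
    X ∩ ({x | subword x 0 w.length ∈ ({w} : Set (List A))} ∩
      {x | subword x (-(j : ℤ)) (j + (w.length + j)) ∈ D})
  have hcl : ∀ j, IsClosed (t j) := fun j =>
    hXcl.inter ((isClosed_setOf_subword_mem _ _ _).inter (isClosed_setOf_subword_mem _ _ _))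
  have hinfix : ∀ (x : ℤ → A) (j : ℕ) (i : ℤ) (n : ℕ), x ∈ t j → -(j : ℤ) ≤ i →
      i + n ≤ w.length + j → subword x i n ∈ D := by
    intro x j i n hx hi hn
    refine hfac _ hx.2.2 _ ?_
    obtain ⟨a, ha⟩ := Int.eq_ofNat_of_zero_le (show 0 ≤ i + j by omega)
    obtain ⟨b, hb⟩ := Int.eq_ofNat_of_zero_le (show 0 ≤ w.length + j - (i + n) by omega)
    have hl : j + (w.length + j) = a + (n + b) := by omega
    refine ⟨subword x (-j) a, subword x (i + n) b, ?_⟩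
    rw [hl, subword_add, subword_add, ← List.append_assoc, show -(j : ℤ) + a = i by omega]
  have hmono : ∀ j, t (j + 1) ⊆ t j := fun j x hx =>
    ⟨hx.1, hx.2.1, hinfix x (j + 1) _ _ hx (by push_cast; omega) (by push_cast; omega)⟩
  have hne : ∀ j, (t j).Nonempty := by
    intro j
    obtain ⟨u, v, hu, hv, h⟩ := hw j
    rw [List.append_assoc] at h
    obtain ⟨x, hx⟩ := hD h
    obtain ⟨-, h₁⟩ := mem_cylL_append hX hx
    obtain ⟨h₂, -⟩ := mem_cylL_append hX h₁
    obtain ⟨hX', hx'⟩ := mem_cylL_iff.1 hx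
    refine ⟨_, (mem_cylL_iff.1 h₂).1, (mem_cylL_iff.1 h₂).2, ?_⟩
    change subword _ _ _ ∈ D
    rw [subword_shift_iterate, hu, neg_add_cancel]
    simp only [List.length_append, hu, hv] at hx'
    rwa [hx']
  obtain ⟨x, hx⟩ := IsCompact.nonempty_iInter_of_sequence_nonempty_isCompact_isClosed t hmono hne
    (hcl 0).isCompact hcl
  rw [Set.mem_iInter] at hx
  refine ⟨x, mem_cylL_iff.2 ⟨⟨(hx 0).1, fun i n => ?_⟩, (hx 0).2.1⟩⟩
  exact hinfix x (i.natAbs + n) i n (hx _) (by omega) (by omega)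

theorem exists_extCore_subset_langSet {X : Set (ℤ → A)} (hXcl : IsClosed X)
    (hX : ∀ x ∈ X, shift x ∈ X) {D : Set (List A)} (hD : D ⊆ langSet X)
    (hfac : ∀ w ∈ D, ∀ u : List A, u <:+: w → u ∈ D) (n : ℕ) :
    ∃ j, ∀ w ∈ extCore D j, w.length = n → w ∈ langSet (subshiftOf X D) := by
  have h : ∀ w : Fin n → A, ∃ j, List.ofFn w ∈ extCore D j →
      List.ofFn w ∈ langSet (subshiftOf X D) := by
    intro w
    by_contra! hw
    exact (hw 0).2 (mem_langSet_subshiftOf hXcl hX hD hfac fun j => (hw j).1)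
  choose f hf using h
  refine ⟨Finset.univ.sup f, fun w hw hn => ?_⟩
  subst hn
  have h := hf w.get
  rw [List.ofFn_get] at h
  exact h (extCore_antitone hfac (Finset.le_sup (Finset.mem_univ _)) hw)

theorem exists_forall_agree_abs_sub_le {X : Set (ℤ → A)} (hXcl : IsClosed X)
    {φ : (ℤ → A) → ℝ} (hφ : ContinuousOn φ X) {ε : ℝ} (hε : 0 < ε) :
    ∃ r : ℕ, ∀ x ∈ X, ∀ y ∈ X, (∀ i : ℤ, i.natAbs ≤ r → x i = y i) → |φ x - φ y| ≤ ε := by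
  by_contra! h
  let t : ℕ → Set ((ℤ → A) × (ℤ → A)) := fun r =>
    ((X ×ˢ X) ∩ (fun p => |φ p.1 - φ p.2|) ⁻¹' Set.Ici ε) ∩
      ⋂ (i : ℤ) (_ : i.natAbs ≤ r), {p | p.1 i = p.2 i}
  have hc : ContinuousOn (fun p : (ℤ → A) × (ℤ → A) => |φ p.1 - φ p.2|) (X ×ˢ X) :=
    ((hφ.comp continuousOn_fst fun p hp => hp.1).sub
      (hφ.comp continuousOn_snd fun p hp => hp.2)).abs
  have hcl : ∀ r, IsClosed (t r) := fun r =>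
    (hc.preimage_isClosed_of_isClosed (hXcl.prod hXcl) isClosed_Ici).inter
      (isClosed_iInter fun i => isClosed_iInter fun _ =>
        isClosed_eq (by fun_prop) (by fun_prop))
  have hmono : ∀ r, t (r + 1) ⊆ t r := by
    intro r p hp
    refine ⟨hp.1, ?_⟩
    have := hp.2
    simp only [Set.mem_iInter] at this ⊢
    exact fun i hi => this i (by omega)
  have hne : ∀ r, (t r).Nonempty := by
    intro r
    obtain ⟨x, hx, y, hy, hxy, hlt⟩ := h r
    refine ⟨(x, y), ⟨⟨hx, hy⟩, hlt.le⟩, ?_⟩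
    simp only [Set.mem_iInter]
    exact hxy
  obtain ⟨p, hp⟩ := IsCompact.nonempty_iInter_of_sequence_nonempty_isCompact_isClosed t hmono hne
    (hcl 0).isCompact hcl
  rw [Set.mem_iInter] at hp
  have heq : p.1 = p.2 := by
    funext i
    have := (hp i.natAbs).2
    simp only [Set.mem_iInter] at this
    exact this i le_rfl
  have hge : ε ≤ |φ p.1 - φ p.2| := (hp 0).1.2
  rw [heq, sub_self, abs_zero] at hge
  exact hε.not_ge hge

theorem exists_birk_sub_le {X : Set (ℤ → A)} (hXcl : IsClosed X) (hX : ∀ x ∈ X, shift x ∈ X)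
    {φ : (ℤ → A) → ℝ} (hφ : ContinuousOn φ X) {M : ℝ} (hM0 : 0 ≤ M)
    (hM : ∀ x ∈ X, |φ x| ≤ M) {ε : ℝ} (hε : 0 < ε) :
    ∃ C : ℝ, ∀ w : List A, ∀ x ∈ cylL X w, ∀ y ∈ cylL X w,
      birk φ w.length x ≤ C + w.length * ε + birk φ w.length y := by
  obtain ⟨r, hr⟩ := exists_forall_agree_abs_sub_le hXcl hφ hε
  refine ⟨(2 * r) * (2 * M), fun w x hx y hy => ?_⟩
  set n := w.length with hn
  let S : Finset ℕ := {k ∈ Finset.range n | ¬(r ≤ k ∧ k + r < n)}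
  have hS : S.card ≤ 2 * r := by
    have : S ⊆ Finset.range r ∪ Finset.Ico (n - r) n := by
      intro k hk
      simp only [S, Finset.mem_filter, Finset.mem_range, Finset.mem_union, Finset.mem_Ico] at hk ⊢
      omega
    refine (Finset.card_le_card this).trans ((Finset.card_union_le _ _).trans ?_)
    simp only [Finset.card_range, Nat.card_Ico]
    omega
  have hterm : ∀ k ∈ Finset.range n, φ (shift^[k] x) - φ (shift^[k] y) ≤
      ε + if ¬(r ≤ k ∧ k + r < n) then 2 * M else 0 := by
    intro k hk
    have hxk := shift_iterate_mem hX hx.1 k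
    have hyk := shift_iterate_mem hX hy.1 k
    split_ifs with hc
    · rw [add_zero]
      refine (le_abs_self _).trans (hr _ hxk _ hyk fun i hi => ?_)
      rw [shift_iterate_apply, shift_iterate_apply]
      obtain ⟨a, ha⟩ := Int.eq_ofNat_of_zero_le (show 0 ≤ i + k by omega)
      have han : a < w.length := by omega
      rw [ha]
      exact (hx.2 ⟨a, han⟩).trans (hy.2 ⟨a, han⟩).symm
    · have := (abs_le.1 (hM _ hxk)).2
      have := (abs_le.1 (hM _ hyk)).1
      linarith
  have hsum := Finset.sum_le_sum hterm
  rw [Finset.sum_sub_distrib, Finset.sum_add_distrib, ← Finset.sum_filter] at hsum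
  simp only [Finset.sum_const, nsmul_eq_mul, Finset.card_range] at hsum
  have hS' : (S.card : ℝ) * (2 * M) ≤ (2 * r) * (2 * M) :=
    mul_le_mul_of_nonneg_right (by exact_mod_cast hS) (by linarith)
  change birk φ n x - birk φ n y ≤ n * ε + S.card * (2 * M) at hsum
  linarith

end Compactness

section Growth

variable {A : Type*} [Fintype A]

theorem tendsto_log_LamD_div_zero {X : Set (ℤ → A)} {φ : (ℤ → A) → ℝ} {D : Set (List A)} {N : ℕ}
    (h : ∀ w ∈ D, w.length < N) :
    Tendsto (fun n : ℕ => Real.log (LamD X φ D n) / n) atTop (nhds 0) := by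
  refine tendsto_const_nhds.congr' ?_
  filter_upwards [eventually_ge_atTop N] with n hn
  rw [LamD_eq_zero X φ fun w hw => ((h w hw).trans_le hn).ne]
  simp

theorem lim_log_LamD_mul_le [TopologicalSpace A] [DiscreteTopology A] {X : Set (ℤ → A)}
    (hXcl : IsClosed X) (hX : ∀ x ∈ X, shift x ∈ X) {φ : (ℤ → A) → ℝ} {M : ℝ}
    (hM : ∀ x ∈ X, |φ x| ≤ M) {D : Set (List A)} (hD : D ⊆ langSet X)
    (hfac : ∀ w ∈ D, ∀ u : List A, u <:+: w → u ∈ D) (hpos : ∀ n, 0 < LamD X φ D n)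
    {n : ℕ} (hn : n ≠ 0) (hposn : 0 < LamD X φ (langSet (subshiftOf X D)) n) {P : ℝ}
    (hP : ∀ m : ℕ, m ≠ 0 → P ≤ Real.log (LamD X φ D m) / m) :
    P * n ≤ Real.log (LamD X φ (langSet (subshiftOf X D)) n) := by
  obtain ⟨j, hj⟩ := exists_extCore_subset_langSet hXcl hX hD hfac n
  set c := LamD X φ (langSet (subshiftOf X D)) n
  have hc : LamD X φ (extCore D j) n ≤ c := by
    simpa using LamD_le_mul_of_forall (X := X) (Y := X) (φ := φ) (c := 0)
      fun w hw hwn => ⟨hj w hw hwn, (zero_add (PhiL X φ w)).ge⟩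
  have key : ∀ k : ℕ, (k + 1) * (P * n - Real.log c) ≤
      2 * Real.log (LamD X φ D j) - 2 * j * P := by
    intro k
    have h₁ : LamD X φ D (j + (n * (k + 1) + j)) ≤
        LamD X φ D j * (c ^ (k + 1) * LamD X φ D j) := by
      refine (LamD_le_extCore hX hM hD hfac j (n * (k + 1))).trans ?_
      refine mul_le_mul_of_nonneg_left ?_ (hpos j).le
      refine mul_le_mul_of_nonneg_right ?_ (hpos j).le
      refine (LamD_mul_le_pow hX hM ((extCore_subset hfac j).trans hD)
        (extCore_factorial hfac j) n k).trans ?_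
      exact pow_le_pow_left₀ (LamD_nonneg _ _ _ _) hc _
    have h₂ := Real.log_le_log (hpos _) h₁
    rw [Real.log_mul (hpos j).ne' (mul_pos (pow_pos hposn _) (hpos j)).ne',
      Real.log_mul (pow_pos hposn _).ne' (hpos j).ne', Real.log_pow] at h₂
    have hm : 0 < j + (n * (k + 1) + j) := by positivity
    have h₃ := hP _ hm.ne'
    rw [le_div_iff₀ (by exact_mod_cast hm)] at h₃
    push_cast at h₂ h₃
    linarith
  by_contra! hlt
  obtain ⟨k, hk⟩ := exists_nat_gt
    ((2 * Real.log (LamD X φ D j) - 2 * j * P) / (P * n - Real.log c))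
  rw [div_lt_iff₀ (sub_pos.2 hlt)] at hk
  linarith [key k]

end Growth

/-- For a factorial collection `D ⊆ L`, the exponential growth rate of `Λ_n(D)`
equals the topological pressure `P(X_D, φ)` of the subshift `X_D`. -/
theorem pressure_of_factorial_collection {A : Type*} [Fintype A]
    [TopologicalSpace A] [DiscreteTopology A]
    (X : Set (ℤ → A)) (hXcl : IsClosed X) (hXinv : shift '' X = X)
    (φ : (ℤ → A) → ℝ) (hφ : ContinuousOn φ X)
    (D : Set (List A)) (hDL : D ⊆ langSet X)
    (hfac : ∀ w ∈ D, ∀ u : List A, u <:+: w → u ∈ D) :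
    ∃ P' : ℝ,
      Tendsto (fun n : ℕ =>
        Real.log (LamD (subshiftOf X D) φ (langSet (subshiftOf X D)) n) / n)
        atTop (nhds P') ∧
      Tendsto (fun n : ℕ => Real.log (LamD X φ D n) / n) atTop (nhds P') := by
  have hX : ∀ x ∈ X, shift x ∈ X := fun x hx => hXinv ▸ Set.mem_image_of_mem shift hx
  obtain ⟨M, hM0, hM⟩ : ∃ M : ℝ, 0 ≤ M ∧ ∀ x ∈ X, |φ x| ≤ M := by
    obtain ⟨M, hM⟩ := hXcl.isCompact.exists_bound_of_continuousOn hφ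
    exact ⟨max M 0, le_max_right _ _, fun x hx => (hM x hx).trans (le_max_left _ _)⟩
  set Y := subshiftOf X D
  have hYX : Y ⊆ X := subshiftOf_subset X D
  have hLD : langSet Y ⊆ D := langSet_subshiftOf_subset X D
  by_cases hne : ∀ n, ∃ w ∈ D, w.length = n
  swap
  · push Not at hne
    obtain ⟨N, hN⟩ := hne
    have hlt : ∀ w ∈ D, w.length < N := fun w hw => by
      by_contra! h
      exact hN _ (hfac w hw _ (List.take_prefix N w).isInfix) (by simp [h])
    exact ⟨0, tendsto_log_LamD_div_zero fun w hw => hlt w (hLD hw),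
      tendsto_log_LamD_div_zero hlt⟩
  have hY : ∀ x ∈ Y, shift x ∈ Y := shift_mem_subshiftOf hX D
  have hMY : ∀ x ∈ Y, |φ x| ≤ M := fun x hx => hM x (hYX hx)
  have hneY : ∀ n, ∃ w ∈ langSet Y, w.length = n := by
    have hnil : ([] : List A) ∈ langSet Y := by
      refine mem_langSet_subshiftOf hXcl hX hDL hfac fun j => ?_
      obtain ⟨w, hw, hwj⟩ := hne (j + j)
      exact ⟨w.take j, w.drop j, by simp [hwj], by simp [hwj], by simpa using hw⟩
    obtain ⟨x, hx⟩ := hnil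
    exact fun n => ⟨subword x 0 n, ⟨x, mem_cylL_iff.2 ⟨hx.1, by simp⟩⟩, by simp⟩
  have hpos : ∀ n, 0 < LamD X φ D n := fun n => by
    obtain ⟨w, hw, rfl⟩ := hne n
    exact (Real.exp_pos _).trans_le (exp_neg_le_LamD hX hM hDL hw)
  have hposY : ∀ n, 0 < LamD Y φ (langSet Y) n := fun n => by
    obtain ⟨w, hw, rfl⟩ := hneY n
    exact (Real.exp_pos _).trans_le (exp_neg_le_LamD hY hMY subset_rfl hw)
  have hsub := subadditive_log_LamD hX hM hDL (fun u v h =>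
    ⟨hfac _ h _ (List.prefix_append u v).isInfix, hfac _ h _ (List.suffix_append u v).isInfix⟩) hpos
  have hbdd := bddBelow_log_LamD_div hX hM hDL hne
  have hlim := hsub.tendsto_lim hbdd
  have hlimY := (subadditive_log_LamD hY hMY subset_rfl (fun u v h => langSet_append hY h)
    hposY).tendsto_lim (bddBelow_log_LamD_div hY hMY subset_rfl hneY)
  set P := hsub.lim
  set Q := Subadditive.lim _
  have hQP : Q ≤ P := by
    refine le_of_tendsto_of_tendsto' hlimY hlim fun n => ?_
    refine div_le_div_of_nonneg_right (Real.log_le_log (hposY n) ?_) n.cast_nonneg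
    simpa using LamD_le_mul_of_forall (X := Y) (Y := X) (φ := φ) (c := 0) fun w hw _ =>
      ⟨hLD hw, by
        rw [zero_add]
        exact PhiL_le hw fun x hx => birk_le_PhiL hX hM (cylL_mono hYX w hx)⟩
  have hPQ : P ≤ Q := by
    refine le_of_forall_pos_le_add fun ε hε => ?_
    obtain ⟨C, hC⟩ := exists_birk_sub_le hXcl hX hφ hM0 hM hε
    have hlim' : Tendsto (fun n : ℕ => C / n + ε + Real.log (LamD Y φ (langSet Y) n) / n) atTop
        (nhds (0 + ε + Q)) :=
      ((tendsto_const_div_atTop_nhds_zero_nat C).add_const ε).add hlimY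
    rw [zero_add, add_comm] at hlim'
    refine ge_of_tendsto hlim' ?_
    filter_upwards [eventually_ne_atTop 0] with n hn
    have hle : LamD X φ (langSet Y) n ≤ Real.exp (C + n * ε) * LamD Y φ (langSet Y) n := by
      refine LamD_le_mul_of_forall fun w hw hwn => ⟨hw, ?_⟩
      obtain ⟨y, hy⟩ := hw
      refine PhiL_le ⟨y, cylL_mono hYX w hy⟩ fun x hx => ?_
      have h₁ := hC w x hx y (cylL_mono hYX w hy)
      have h₂ := birk_le_PhiL hY hMY hy
      rw [hwn] at h₁ h₂ ⊢
      linarith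
    have hposn : 0 < LamD X φ (langSet Y) n := by
      obtain ⟨w, hw, rfl⟩ := hneY n
      exact (Real.exp_pos _).trans_le (exp_neg_le_LamD hX hM (hLD.trans hDL) hw)
    have h₁ := lim_log_LamD_mul_le hXcl hX hM hDL hfac hpos hn hposn
      fun m hm => hsub.lim_le_div hbdd hm
    have h₂ := Real.log_le_log hposn hle
    rw [Real.log_mul (Real.exp_ne_zero _) (hposY n).ne', Real.log_exp] at h₂
    have hn' : (0 : ℝ) < n := by exact_mod_cast Nat.pos_of_ne_zero hn
    have h₃ : C / n + ε + Real.log (LamD Y φ (langSet Y) n) / n =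
        (C + n * ε + Real.log (LamD Y φ (langSet Y) n)) / n := by
      field_simp
    rw [h₃, le_div_iff₀ hn']
    exact h₁.trans h₂
  exact ⟨P, le_antisymm hQP hPQ ▸ hlimY, hlim⟩
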